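/- Let F : [0,1] → ℝ be the Cantor function (Cantor–Lebesgue 'devil's staircase') and let E ⊂ [0,1] be the Cantor ternary set. Then the associated interval function Φ([u,v]) = F(v) − F(u) of F is basically summable to the sum 1 on E; that is, for every ε > 0 there exists a gauge δ_ε on [0,1] such that |Σ_Φ(P|_E) − 1| < ε for every δ_ε-fine tagged partition P of [0,1]. -/

import Mathlib

/-- A tagged partition `P = {([aᵢ, bᵢ], xᵢ)}` of a compact interval `[a, b]`, given by
division points `a = c 0 < c 1 < ⋯ < c ν = b` together with tags `t i ∈ [c i, c (i+1)]`. -/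
structure TaggedPartition (a b : ℝ) where
  ν : ℕ
  c : Fin (ν + 1) → ℝ
  t : Fin ν → ℝ
  mono : StrictMono c
  first : c 0 = a
  last : c (Fin.last ν) = b
  tag_mem : ∀ i : Fin ν, t i ∈ Set.Icc (c i.castSucc) (c i.succ)

/-- `δ` is a gauge on `[a, b]`: it is positive at each point of `[a, b]`. -/
def IsGauge (a b : ℝ) (δ : ℝ → ℝ) : Prop :=
  ∀ x ∈ Set.Icc a b, 0 < δ x

/-- `P` is `δ`-fine: each `[aᵢ, bᵢ]` is contained in `(xᵢ - δ xᵢ, xᵢ + δ xᵢ)`. -/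
def TaggedPartition.IsFine {a b : ℝ} (P : TaggedPartition a b) (δ : ℝ → ℝ) : Prop :=
  ∀ i : Fin P.ν, Set.Icc (P.c i.castSucc) (P.c i.succ) ⊆
    Set.Ioo (P.t i - δ (P.t i)) (P.t i + δ (P.t i))

/-- The Riemann sum `Ξ_f(P) = Σᵢ f (xᵢ) (bᵢ - aᵢ)`. -/
def riemannSum {a b : ℝ} (f : ℝ → ℝ) (P : TaggedPartition a b) : ℝ :=
  ∑ i : Fin P.ν, f (P.t i) * (P.c i.succ - P.c i.castSucc)

/-- The sum `Σ_Φ(P) = Σᵢ Φ([aᵢ, bᵢ])` of an interval function `Φ`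
(an interval function is recorded as a function of the two endpoints). -/
def intervalSum {a b : ℝ} (Φ : ℝ → ℝ → ℝ) (P : TaggedPartition a b) : ℝ :=
  ∑ i : Fin P.ν, Φ (P.c i.castSucc) (P.c i.succ)

open Classical in
/-- The restricted sum `Σ_Φ(P|_E)`, over the interval-point pairs of `P` whose tag lies
in `E`. -/
noncomputable def intervalSumOn {a b : ℝ} (Φ : ℝ → ℝ → ℝ) (P : TaggedPartition a b)
    (E : Set ℝ) : ℝ :=
  ∑ i : Fin P.ν, if P.t i ∈ E then Φ (P.c i.castSucc) (P.c i.succ) else 0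

/-- `f` is Kurzweil–Henstock integrable to `A` on `[a, b]`. -/
def KHIntegralTo (a b : ℝ) (f : ℝ → ℝ) (A : ℝ) : Prop :=
  ∀ ε > 0, ∃ δ : ℝ → ℝ, IsGauge a b δ ∧
    ∀ P : TaggedPartition a b, P.IsFine δ → |riemannSum f P - A| < ε

/-- `f` is totally Kurzweil–Henstock integrable to `I` on `[a, b]` (relative to the
exceptional set `E`), witnessed by the interval function `Φ`: for every `ε > 0` there is a
gauge `δ` such that `|Ξ_f(P) - Σ_Φ(P|_{[a,b] \ E})| < ε` and `Σ_Φ(P) = I` for every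
`δ`-fine tagged partition `P` of `[a, b]`. -/
def TotalKHIntegralWith (a b : ℝ) (E : Set ℝ) (f : ℝ → ℝ) (Φ : ℝ → ℝ → ℝ) (I : ℝ) : Prop :=
  ∀ ε > 0, ∃ δ : ℝ → ℝ, IsGauge a b δ ∧
    ∀ P : TaggedPartition a b, P.IsFine δ →
      |riemannSum f P - intervalSumOn Φ P (Set.Icc a b \ E)| < ε ∧ intervalSum Φ P = I

/-- The interval function `Φ` is basically summable (BS) to the sum `R` on `E ⊆ [a, b]`. -/
def BasicallySummable (a b : ℝ) (E : Set ℝ) (Φ : ℝ → ℝ → ℝ) (R : ℝ) : Prop :=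
  ∀ ε > 0, ∃ δ : ℝ → ℝ, IsGauge a b δ ∧
    ∀ P : TaggedPartition a b, P.IsFine δ → |intervalSumOn Φ P E - R| < ε

lemma one_mem_preCantorSet (n : ℕ) : (1 : ℝ) ∈ preCantorSet n := by
  induction n with
  | zero => simp
  | succ n ih => exact Or.inr ⟨1, ih, by norm_num⟩

lemma Fin.sum_univ_succ_sub_castSucc {M : Type*} [AddCommGroup M] {n : ℕ} (g : Fin (n + 1) → M) :
    ∑ i : Fin n, (g i.succ - g i.castSucc) = g (Fin.last n) - g 0 := by
  have h := (Fin.sum_univ_succ g).symm.trans (Fin.sum_univ_castSucc g)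
  rw [Finset.sum_sub_distrib, sub_eq_sub_iff_add_eq_add, add_comm, h, add_comm]

lemma TaggedPartition.c_mem_Icc {a b : ℝ} (P : TaggedPartition a b) (i : Fin (P.ν + 1)) :
    P.c i ∈ Set.Icc a b := by
  constructor
  · simpa only [P.first] using P.mono.monotone (Fin.zero_le i)
  · simpa only [P.last] using P.mono.monotone (Fin.le_last i)

lemma TaggedPartition.t_mem_Icc {a b : ℝ} (P : TaggedPartition a b) (i : Fin P.ν) :
    P.t i ∈ Set.Icc a b :=
  Set.Icc_subset_Icc (P.c_mem_Icc _).1 (P.c_mem_Icc _).2 (P.tag_mem i)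

/-- The sum of the increments of a point function `F` telescopes. -/
lemma intervalSum_sub {a b : ℝ} (F : ℝ → ℝ) (P : TaggedPartition a b) :
    intervalSum (fun u v => F v - F u) P = F b - F a := by
  have h := Fin.sum_univ_succ_sub_castSucc (fun i => F (P.c i))
  rwa [P.first, P.last] at h

/-- A point function that is locally constant at the points of `[a, b] \ E` has an associated
interval function that is basically summable on `E` to its total increment. -/
lemma basicallySummable_of_locally_const {a b : ℝ} {E : Set ℝ} {F : ℝ → ℝ}
    (h : ∀ x ∈ Set.Icc a b, x ∉ E → ∃ d > 0, ∀ y ∈ Set.Icc a b, |y - x| < d → F y = F x) :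
    BasicallySummable a b E (fun u v => F v - F u) (F b - F a) := by
  intro ε hε
  have h' : ∀ x, ∃ d > 0, x ∈ Set.Icc a b → x ∉ E →
      ∀ y ∈ Set.Icc a b, |y - x| < d → F y = F x := by
    intro x
    by_cases hx : x ∈ Set.Icc a b ∧ x ∉ E
    · obtain ⟨d, hd, hF⟩ := h x hx.1 hx.2
      exact ⟨d, hd, fun _ _ => hF⟩
    · exact ⟨1, one_pos, fun h₁ h₂ => absurd ⟨h₁, h₂⟩ hx⟩
  choose δ hδ hF using h'
  refine ⟨δ, fun x _ => hδ x, fun P hP => ?_⟩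
  have key : intervalSumOn (fun u v => F v - F u) P E = F b - F a := by
    rw [← intervalSum_sub F P]
    refine Finset.sum_congr rfl fun i _ => ?_
    split_ifs with hE
    · rfl
    · have hle : P.c i.castSucc ≤ P.c i.succ := (P.tag_mem i).1.trans (P.tag_mem i).2
      have hconst : ∀ j, P.c j ∈ Set.Icc (P.c i.castSucc) (P.c i.succ) →
          F (P.c j) = F (P.t i) := fun j hj =>
        hF _ (P.t_mem_Icc i) hE _ (P.c_mem_Icc j)
          (by have := hP i hj; rw [abs_lt]; constructor <;> linarith [this.1, this.2])
      beta_reduce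
      rw [hconst _ (Set.right_mem_Icc.2 hle), hconst _ (Set.left_mem_Icc.2 hle), sub_self]
  rwa [key, sub_self, abs_zero]

/-- A monotone function with the self-similarity of the Cantor function is locally constant off
the pre-Cantor sets. -/
lemma locally_const_of_notMem_preCantorSet {F : ℝ → ℝ}
    (hmono : MonotoneOn F (Set.Icc 0 1)) (h0 : F 0 = 0) (h1 : F 1 = 1)
    (hself₀ : ∀ x ∈ Set.Icc (0 : ℝ) 1, F (x / 3) = F x / 2)
    (hself₂ : ∀ x ∈ Set.Icc (0 : ℝ) 1, F ((2 + x) / 3) = (1 + F x) / 2)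
    (n : ℕ) : ∀ x ∈ Set.Icc (0 : ℝ) 1, x ∉ preCantorSet n →
      ∃ d > 0, ∀ y ∈ Set.Icc (0 : ℝ) 1, |y - x| < d → F y = F x := by
  induction n with
  | zero => exact fun x hx hn => absurd hx hn
  | succ n ih =>
    intro x hx hn
    rw [preCantorSet_succ, Set.mem_union, not_or] at hn
    obtain ⟨hl, hr⟩ := hn
    rcases le_or_gt x (1 / 3) with hx₁ | hx₁
    · have hne : x ≠ 1 / 3 := fun h => hl ⟨1, one_mem_preCantorSet n, h.symm⟩
      have hlt : x < 1 / 3 := lt_of_le_of_ne hx₁ hne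
      obtain ⟨d, hd, hF⟩ := ih (3 * x) ⟨by linarith [hx.1], by linarith⟩
        fun h => hl ⟨3 * x, h, by ring⟩
      refine ⟨min (d / 3) (1 / 3 - x), lt_min (by linarith) (by linarith), fun y hy hyx => ?_⟩
      obtain ⟨hyd, hy₁⟩ := lt_min_iff.1 hyx
      rw [abs_lt] at hyd hy₁
      have e := hF (3 * y) ⟨by linarith [hy.1], by linarith⟩
        (by rw [abs_lt]; constructor <;> linarith)
      have ey := hself₀ (3 * y) ⟨by linarith [hy.1], by linarith⟩
      have ex := hself₀ (3 * x) ⟨by linarith [hx.1], by linarith⟩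
      rw [mul_div_cancel_left₀ _ three_ne_zero] at ey ex
      rw [ey, ex, e]
    · rcases lt_or_ge x (2 / 3) with hx₂ | hx₂
      · have hF : ∀ z ∈ Set.Icc (1 / 3 : ℝ) (2 / 3), F z = 1 / 2 := by
          intro z hz
          have a₁ := hself₀ 1 (by norm_num)
          have a₂ := hself₂ 0 (by norm_num)
          rw [h1] at a₁
          rw [h0, add_zero, add_zero] at a₂
          have hz' : z ∈ Set.Icc (0 : ℝ) 1 := ⟨by linarith [hz.1], by linarith [hz.2]⟩
          exact le_antisymm (a₂ ▸ hmono hz' (by norm_num) hz.2)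
            (a₁ ▸ hmono (by norm_num) hz' hz.1)
        refine ⟨min (x - 1 / 3) (2 / 3 - x), lt_min (by linarith) (by linarith),
          fun y _ hyx => ?_⟩
        obtain ⟨hy₁, hy₂⟩ := lt_min_iff.1 hyx
        rw [abs_lt] at hy₁ hy₂
        rw [hF y ⟨by linarith, by linarith⟩, hF x ⟨hx₁.le, hx₂.le⟩]
      · have hne : x ≠ 2 / 3 := fun h => hr ⟨0, zero_mem_preCantorSet n, by simp [h]⟩
        have hlt : 2 / 3 < x := lt_of_le_of_ne hx₂ hne.symm
        obtain ⟨d, hd, hF⟩ := ih (3 * x - 2) ⟨by linarith, by linarith [hx.2]⟩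
          fun h => hr ⟨3 * x - 2, h, by ring⟩
        refine ⟨min (d / 3) (x - 2 / 3), lt_min (by linarith) (by linarith), fun y hy hyx => ?_⟩
        obtain ⟨hyd, hy₁⟩ := lt_min_iff.1 hyx
        rw [abs_lt] at hyd hy₁
        have e := hF (3 * y - 2) ⟨by linarith, by linarith [hy.2]⟩
          (by rw [abs_lt]; constructor <;> linarith)
        have ey := hself₂ (3 * y - 2) ⟨by linarith, by linarith [hy.2]⟩
        have ex := hself₂ (3 * x - 2) ⟨by linarith, by linarith [hx.2]⟩
        rw [add_sub_cancel, mul_div_cancel_left₀ _ three_ne_zero] at ey ex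
        rw [ey, ex, e]

/-- Let `F` be the Cantor function on `[0, 1]` (characterized as the
unique function that is monotone on `[0, 1]`, continuous on `[0, 1]`, satisfies
`F 0 = 0`, `F 1 = 1`, and the self-similarity relations `F (x / 3) = F x / 2` and
`F ((2 + x) / 3) = (1 + F x) / 2` for `x ∈ [0, 1]`). Then the associated interval
function `Φ([u, v]) = F v - F u` of `F` is basically summable to the sum `1` on the
Cantor ternary set. -/
theorem cantor_basicallySummable (F : ℝ → ℝ)
    (hmono : MonotoneOn F (Set.Icc 0 1))
    (hcont : ContinuousOn F (Set.Icc 0 1))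
    (h0 : F 0 = 0) (h1 : F 1 = 1)
    (hself₀ : ∀ x ∈ Set.Icc (0 : ℝ) 1, F (x / 3) = F x / 2)
    (hself₂ : ∀ x ∈ Set.Icc (0 : ℝ) 1, F ((2 + x) / 3) = (1 + F x) / 2) :
    BasicallySummable 0 1 cantorSet (fun u v => F v - F u) 1 := by
  have h := basicallySummable_of_locally_const (a := 0) (b := 1) (E := cantorSet) (F := F) ?_
  · rwa [h0, h1, sub_zero] at h
  · intro x hx hxE
    obtain ⟨n, hn⟩ := not_forall.1 (mt Set.mem_iInter.2 hxE)
    exact locally_const_of_notMem_preCantorSet hmono h0 h1 hself₀ hself₂ n x hx hn
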